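/- The n×n matrix T_n^R, tridiagonal of all ones except with (1,1) entry 2 and (n,n) entry 2, is nonsingular if and only if 3 does not divide n. -/

import Mathlib

open Matrix

/-- Reflexive upper shift matrix: superdiagonal 1's plus an extra 1 at entry `(n,n)`. -/
def URmat (n : ℕ) : Matrix (Fin n) (Fin n) ℝ :=
  Matrix.of fun i j =>
    if (i : ℕ) + 1 = (j : ℕ) ∨ ((i : ℕ) = (j : ℕ) ∧ (i : ℕ) = n - 1) then 1 else 0

/-- Reflexive lower shift matrix: subdiagonal 1's plus an extra 1 at entry `(1,1)`. -/
def LRmat (n : ℕ) : Matrix (Fin n) (Fin n) ℝ :=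
  Matrix.of fun i j =>
    if (j : ℕ) + 1 = (i : ℕ) ∨ ((i : ℕ) = (j : ℕ) ∧ (i : ℕ) = 0) then 1 else 0

lemma T_apply (n : ℕ) (w : ℕ → ℝ) (h0 : w 0 = w 1) (hn : w (n + 1) = w n) (i : Fin n) :
    ((LRmat n + (1 : Matrix (Fin n) (Fin n) ℝ) + URmat n) *ᵥ fun j : Fin n => w (j + 1)) i
      = w i + w (i + 1) + w (i + 2) := by
  have hi := i.2
  have hL : (LRmat n *ᵥ fun j : Fin n => w (j + 1)) i = w i := by
    have : ∀ j : Fin n, LRmat n i j = if j = ⟨i - 1, by omega⟩ then 1 else 0 := by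
      intro j
      simp only [LRmat, Matrix.of_apply, Fin.ext_iff]
      congr 1
      apply propext
      omega
    simp only [Matrix.mulVec, dotProduct, this, ite_mul, one_mul, zero_mul, Finset.sum_ite_eq',
      Finset.sum_ite_eq, Finset.mem_univ, if_true]
    by_cases h : (i : ℕ) = 0
    · simp [h, h0]
    · congr 1
      omega
  have hU : (URmat n *ᵥ fun j : Fin n => w (j + 1)) i = w (i + 2) := by
    have : ∀ j : Fin n, URmat n i j = if j = ⟨min (i + 1) (n - 1), by omega⟩ then 1 else 0 := by
      intro j
      have hj := j.2
      simp only [URmat, Matrix.of_apply, Fin.ext_iff]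
      congr 1
      apply propext
      omega
    simp only [Matrix.mulVec, dotProduct, this, ite_mul, one_mul, zero_mul, Finset.sum_ite_eq',
      Finset.sum_ite_eq, Finset.mem_univ, if_true]
    by_cases h : (i : ℕ) + 1 = n
    · have e1 : min ((i : ℕ) + 1) (n - 1) + 1 = n := by omega
      have e2 : (i : ℕ) + 2 = n + 1 := by omega
      rw [e1, e2, hn]
    · congr 1
      omega
  rw [Matrix.add_mulVec, Matrix.add_mulVec, Matrix.one_mulVec, Pi.add_apply, Pi.add_apply, hL, hU]

/-- The periodic pattern `1, 1, -2`. -/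
def pat (k : ℕ) : ℝ := if k % 3 = 2 then -2 else 1

lemma pat_sum (k : ℕ) : pat k + pat (k + 1) + pat (k + 2) = 0 := by
  have h : k % 3 = 0 ∨ k % 3 = 1 ∨ k % 3 = 2 := by omega
  rcases h with h | h | h <;> simp [pat, Nat.add_mod, h] <;> norm_num

lemma pat_unique (n : ℕ) (w : ℕ → ℝ) (h0 : w 0 = w 1)
    (h : ∀ i < n, w i + w (i + 1) + w (i + 2) = 0) :
    ∀ k ≤ n, w k = w 0 * pat k ∧ w (k + 1) = w 0 * pat (k + 1) := by
  intro k
  induction k with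
  | zero => intro _; simp [pat, h0]
  | succ k ih =>
    intro hk
    obtain ⟨h1, h2⟩ := ih (by omega)
    refine ⟨h2, ?_⟩
    have h3 := h k (by omega)
    have h4 := pat_sum k
    have : pat (k + 1 + 1) = - pat k - pat (k + 1) := by linarith
    rw [this]
    have h5 : w (k + 1 + 1) = - w k - w (k + 1) := by linarith
    rw [h5, h1, h2]
    ring

/-- `T_n^R = L_n^R + I + U_n^R` (tridiagonal of ones with `(1,1)` and `(n,n)` entries equal
to `2`) is nonsingular iff `3 ∤ n`. -/
theorem stmt10 (n : ℕ) (hn : 0 < n) :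
    (LRmat n + (1 : Matrix (Fin n) (Fin n) ℝ) + URmat n).det ≠ 0 ↔ ¬ (3 ∣ n) := by
  rw [not_iff_not, ← Matrix.exists_mulVec_eq_zero_iff]
  constructor
  · rintro ⟨v, hv, hT⟩
    by_contra h3
    apply hv
    -- extend `v` by reflection
    let w : ℕ → ℝ := fun k => v ⟨min (k - 1) (n - 1), by omega⟩
    have hw : (fun j : Fin n => w (j + 1)) = v := by
      funext j
      have hj := j.2
      simp only [w]
      congr 1
      apply Fin.ext
      simp only
      omega
    have h0 : w 0 = w 1 := rfl
    have hn' : w (n + 1) = w n := by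
      simp only [w]
      congr 1
      apply Fin.ext
      simp only
      omega
    have hrec : ∀ i < n, w i + w (i + 1) + w (i + 2) = 0 := by
      intro i hi
      have := T_apply n w h0 hn' ⟨i, hi⟩
      rw [hw, hT] at this
      simpa using this.symm
    have hp := pat_unique n w h0 hrec
    obtain ⟨e1, e2⟩ := hp n le_rfl
    have hc : w 0 = 0 := by
      rw [e1, e2] at hn'
      have h : n % 3 = 1 ∨ n % 3 = 2 := by omega
      rcases h with h | h <;> simp [pat, Nat.add_mod, h] at hn' <;> linarith
    rw [← hw]
    funext j
    have := (hp j j.2.le).2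
    rw [hc, zero_mul] at this
    exact this
  · intro h3
    have h : n % 3 = 0 := by omega
    refine ⟨fun j : Fin n => pat (j + 1), ?_, ?_⟩
    · intro h0
      have := congrFun h0 ⟨0, hn⟩
      simp [pat] at this
    · funext i
      rw [T_apply n pat (by simp [pat]) (by simp [pat, Nat.add_mod, h]) i]
      exact pat_sum i
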